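/- The atomicity/controlled-invocation finite state machine of VRASED satisfies the controlled-invocation LTL Specifications (2) and (3). Precisely: for any input trace satisfying Axiom A4 and with 0 < CR_min < CR_max, the run of the five-state FSM (defined in the context) satisfies both G: { ¬reset ∧ (PC ∈ CR) ∧ ¬(X(PC) ∈ CR) → PC = CR_max ∨ X(reset) } (SW-Att can only be exited through its last instruction) and G: { ¬reset ∧ ¬(PC ∈ CR) ∧ (X(PC) ∈ CR) → X(PC) = CR_min ∨ X(reset) } (SW-Att can only be entered through its first instruction). -/

import Mathlib

/-- States of the atomicity/controlled-invocation FSM of VRASED. -/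
inductive S5 where
  | notCR : S5
  | fstCR : S5
  | midCR : S5
  | lstCR : S5
  | Reset : S5
deriving DecidableEq

-- Transition function of the atomicity/controlled-invocation FSM, on inputs (PC, irq).
open Classical in
noncomputable def atomDelta (CRmin CRmax : ℕ) (PC : ℕ → ℕ) (irq : ℕ → Prop) :
    S5 → ℕ → S5
  | S5.notCR, t =>
      if PC t < CRmin ∨ PC t > CRmax then S5.notCR
      else if PC t = CRmin ∧ ¬ irq t then S5.fstCR
      else S5.Reset
  | S5.fstCR, t =>
      if PC t = CRmin ∧ ¬ irq t then S5.fstCR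
      else if (CRmin < PC t ∧ PC t < CRmax) ∧ ¬ irq t then S5.midCR
      else S5.Reset
  | S5.midCR, t =>
      if (CRmin < PC t ∧ PC t < CRmax) ∧ ¬ irq t then S5.midCR
      else if PC t = CRmax ∧ ¬ irq t then S5.lstCR
      else S5.Reset
  | S5.lstCR, t =>
      if PC t = CRmax ∧ ¬ irq t then S5.lstCR
      else if (PC t < CRmin ∨ PC t > CRmax) ∧ ¬ irq t then S5.notCR
      else S5.Reset
  | S5.Reset, t =>
      if PC t = 0 then S5.notCR
      else S5.Reset

/-- The range of program counters compatible with each state of the atomicity FSM. -/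
def S5.PCRange (CRmin CRmax pc : ℕ) : S5 → Prop
  | S5.notCR => pc < CRmin ∨ CRmax < pc
  | S5.fstCR => pc = CRmin
  | S5.midCR => CRmin < pc ∧ pc < CRmax
  | S5.lstCR => pc = CRmax
  | S5.Reset => True

/-- The state reached by a transition is compatible with the program counter just read. -/
theorem pcRange_atomDelta {CRmin CRmax : ℕ} (hmin : 0 < CRmin) (PC : ℕ → ℕ)
    (irq : ℕ → Prop) (q : S5) (t : ℕ) :
    (atomDelta CRmin CRmax PC irq q t).PCRange CRmin CRmax (PC t) := by
  cases q <;> simp only [atomDelta] <;> split_ifs <;> simp only [S5.PCRange] <;> omega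

/-- Along a run, every state is compatible with the current program counter. -/
theorem pcRange_run {CRmin CRmax : ℕ} (hmin : 0 < CRmin) {PC : ℕ → ℕ}
    {irq : ℕ → Prop} {s : ℕ → S5} (hs0 : s 0 = S5.Reset)
    (hstep : ∀ t : ℕ, s (t + 1) = atomDelta CRmin CRmax PC irq (s t) (t + 1)) (t : ℕ) :
    (s t).PCRange CRmin CRmax (PC t) := by
  cases t with
  | zero => rw [hs0]; trivial
  | succ t => rw [hstep]; exact pcRange_atomDelta hmin PC irq (s t) (t + 1)

/-- the atomicity/controlled-invocation FSM of VRASED satisfies the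
controlled-invocation LTL Specifications (2) and (3): for any input trace satisfying
Axiom A4 and with 0 < CR_min < CR_max, at every time,
(2) ¬reset ∧ (PC ∈ CR) ∧ ¬(X(PC) ∈ CR) → PC = CR_max ∨ X(reset), and
(3) ¬reset ∧ ¬(PC ∈ CR) ∧ (X(PC) ∈ CR) → X(PC) = CR_min ∨ X(reset),
where reset(t) := (s(t) = Reset). -/
theorem atomicity_fsm_satisfies_spec2_spec3
    (CRmin CRmax : ℕ)
    (hCR : 0 < CRmin ∧ CRmin < CRmax)
    (PC Daddr DMAaddr : ℕ → ℕ)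
    (irq Ren Wen DMAen : ℕ → Prop)
    (s : ℕ → S5)
    (hs0 : s 0 = S5.Reset)
    (hstep : ∀ t : ℕ, s (t + 1) = atomDelta CRmin CRmax PC irq (s t) (t + 1))
    (hA4 : ∀ t : ℕ, PC t = 0 → ¬Ren t ∧ ¬Wen t ∧ ¬DMAen t ∧ ¬irq t) :
    (∀ t : ℕ,
      (¬(s t = S5.Reset) ∧ (CRmin ≤ PC t ∧ PC t ≤ CRmax) ∧
        ¬(CRmin ≤ PC (t + 1) ∧ PC (t + 1) ≤ CRmax)) →
      (PC t = CRmax ∨ s (t + 1) = S5.Reset)) ∧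
    (∀ t : ℕ,
      (¬(s t = S5.Reset) ∧ ¬(CRmin ≤ PC t ∧ PC t ≤ CRmax) ∧
        (CRmin ≤ PC (t + 1) ∧ PC (t + 1) ≤ CRmax)) →
      (PC (t + 1) = CRmin ∨ s (t + 1) = S5.Reset)) := by
  have hinv := pcRange_run hCR.1 hs0 hstep
  constructor <;> rintro t ⟨hreset, hnow, hnext⟩ <;> have ht := hinv t <;> rw [hstep t] <;>
    cases hq : s t <;> simp only [hq, S5.PCRange] at ht <;> simp only [atomDelta] <;>
    split_ifs <;> first | exact absurd hq hreset | exact Or.inr rfl | omega
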